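/- arXiv:1607.01865 — 3 statements merged into one kernel-verified Lean document; each statement's English description precedes it below -/
import Mathlib

section
/- For ε ∈ (0,1) and d ≥ 1 define n(ε,d) = min{n ∈ ℕ : σ^∞_d(n+1) ≤ ε}. Then for α, β > 0 the limit lim_{ε^{-1}+d→∞} ln n(ε,d)/(ε^{-α} + d^{β}) = 0 (over pairs (ε,d) ∈ (0,1)×ℕ_+ with ε^{-1}+d → ∞) holds if and only if α > 2 or β > 1. In particular, the approximation problem I_d : W_2^∞(𝕋^d) → L_2(𝕋^d) is (α,β)-weakly tractable if and only if (α > 2 and β > 0) or (α > 0 and β > 1); it is intractable and does not suffer from the curse of dimensionality. -/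
/-- nonincreasing rearrangement of the weights `(1 + Σ_j |k_j|)^{-1/2}`, `k ∈ {-1,0,1}^d`. -/
noncomputable def sigmaInf (d : ℕ) (n : ℕ) : ℝ :=
  sSup {t : ℝ | 0 < t ∧
    n ≤ Set.ncard {k : Fin d → ℤ | (∀ j, |k j| ≤ 1) ∧
      t ≤ (1 + ∑ j, |(k j : ℝ)|) ^ (-(1 / 2) : ℝ)}}

open Filter Asymptotics

/-- The ternary multi-indices in dimension `d`. -/
noncomputable def ternaryIndices (d : ℕ) : Finset (Fin d → ℤ) :=
  Fintype.piFinset fun _ => Finset.Icc (-1) 1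

lemma mem_ternaryIndices {d : ℕ} {k : Fin d → ℤ} :
    k ∈ ternaryIndices d ↔ ∀ j, |k j| ≤ 1 := by
  simp [ternaryIndices, abs_le]

lemma card_ternaryIndices (d : ℕ) : (ternaryIndices d).card = 3 ^ d := by
  simp [ternaryIndices, Fintype.card_piFinset]

lemma sum_ternaryIndices_exp (d : ℕ) (L : ℝ) :
    ∑ k ∈ ternaryIndices d, Real.exp (-(L * ∑ j, |(k j : ℝ)|)) =
      (1 + 2 * Real.exp (-L)) ^ d := by
  have h : ∑ i ∈ Finset.Icc (-1 : ℤ) 1, Real.exp (-(L * |(i : ℝ)|)) =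
      1 + 2 * Real.exp (-L) := by
    rw [show Finset.Icc (-1 : ℤ) 1 = {-1, 0, 1} by decide]
    simp
    ring
  have := Finset.prod_univ_sum (fun _ : Fin d => Finset.Icc (-1 : ℤ) 1)
    (fun _ i => Real.exp (-(L * |(i : ℝ)|)))
  simp only [h, Finset.prod_const, Finset.card_univ, Fintype.card_fin] at this
  rw [this]
  refine Finset.sum_congr rfl fun k _ => ?_
  rw [← Real.exp_sum, Finset.mul_sum, Finset.sum_neg_distrib]

/-- The ternary multi-indices whose weight exceeds `ε`. -/
noncomputable def heavyIndices (d : ℕ) (ε : ℝ) : Finset (Fin d → ℤ) :=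
  {k ∈ ternaryIndices d | ε < (1 + ∑ j, |(k j : ℝ)|) ^ (-(1 / 2) : ℝ)}

lemma sum_abs_le_of_mem_heavyIndices {d : ℕ} {ε : ℝ} (hε : 0 < ε) {k : Fin d → ℤ}
    (hk : k ∈ heavyIndices d ε) : ∑ j, |(k j : ℝ)| ≤ ε ^ (-2 : ℝ) := by
  have h := (Finset.mem_filter.mp hk).2
  have hs : 0 ≤ ∑ j, |(k j : ℝ)| := Finset.sum_nonneg fun _ _ => abs_nonneg _
  have h2 := Real.rpow_le_rpow_of_nonpos hε h.le (show (-2 : ℝ) ≤ 0 by norm_num)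
  rw [← Real.rpow_mul (by linarith)] at h2
  norm_num at h2
  norm_num
  linarith

lemma card_heavyIndices_le (d : ℕ) {ε L : ℝ} (hε : 0 < ε) (hL : 0 ≤ L) :
    ((heavyIndices d ε).card : ℝ) ≤ Real.exp (L * ε ^ (-2 : ℝ) + 2 * d * Real.exp (-L)) := by
  have h1 : (heavyIndices d ε).card * Real.exp (-(L * ε ^ (-2 : ℝ))) ≤
      (1 + 2 * Real.exp (-L)) ^ d := by
    calc (heavyIndices d ε).card * Real.exp (-(L * ε ^ (-2 : ℝ)))
        = ∑ _k ∈ heavyIndices d ε, Real.exp (-(L * ε ^ (-2 : ℝ))) := by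
          rw [Finset.sum_const, nsmul_eq_mul]
      _ ≤ ∑ k ∈ heavyIndices d ε, Real.exp (-(L * ∑ j, |(k j : ℝ)|)) :=
          Finset.sum_le_sum fun k hk => Real.exp_le_exp.mpr <| neg_le_neg <|
            mul_le_mul_of_nonneg_left (sum_abs_le_of_mem_heavyIndices hε hk) hL
      _ ≤ ∑ k ∈ ternaryIndices d, Real.exp (-(L * ∑ j, |(k j : ℝ)|)) :=
          Finset.sum_le_sum_of_subset_of_nonneg (Finset.filter_subset _ _)
            fun _ _ _ => (Real.exp_pos _).le
      _ = _ := sum_ternaryIndices_exp d L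
  have h2 : (1 + 2 * Real.exp (-L)) ^ d ≤ Real.exp (2 * d * Real.exp (-L)) := by
    have h3 : 1 + 2 * Real.exp (-L) ≤ Real.exp (2 * Real.exp (-L)) := by
      linarith [Real.add_one_le_exp (2 * Real.exp (-L))]
    calc _ ≤ Real.exp (2 * Real.exp (-L)) ^ d := by gcongr
      _ = _ := by rw [← Real.exp_nat_mul]; ring_nf
  rw [Real.exp_neg, ← div_eq_mul_inv, div_le_iff₀ (Real.exp_pos _)] at h1
  rw [Real.exp_add, mul_comm]
  exact h1.trans (by gcongr)

lemma finite_weight_ge (d : ℕ) (t : ℝ) : {k : Fin d → ℤ | (∀ j, |k j| ≤ 1) ∧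
    t ≤ (1 + ∑ j, |(k j : ℝ)|) ^ (-(1 / 2) : ℝ)}.Finite :=
  (ternaryIndices d).finite_toSet.subset fun _ hk => mem_ternaryIndices.mpr hk.1

lemma sigmaInf_card_heavyIndices_le (d : ℕ) {ε : ℝ} (hε : 0 < ε) :
    sigmaInf d ((heavyIndices d ε).card + 1) ≤ ε := by
  refine Real.sSup_le ?_ hε.le
  rintro t ⟨-, ht⟩
  by_contra! h
  have : {k : Fin d → ℤ | (∀ j, |k j| ≤ 1) ∧
      t ≤ (1 + ∑ j, |(k j : ℝ)|) ^ (-(1 / 2) : ℝ)} ⊆ (heavyIndices d ε : Set (Fin d → ℤ)) :=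
    fun k hk => Finset.mem_filter.mpr ⟨mem_ternaryIndices.mpr hk.1, h.trans_le hk.2⟩
  have := Set.ncard_le_ncard this (Finset.finite_toSet _)
  rw [Set.ncard_coe_finset] at this
  exact Nat.not_succ_le_self _ (ht.trans this)

lemma log_complexity_le (d : ℕ) {ε L : ℝ} (hε : 0 < ε) (hL : 0 ≤ L) :
    Real.log ((sInf {n : ℕ | sigmaInf d (n + 1) ≤ ε} : ℕ) : ℝ) ≤
      L * ε ^ (-2 : ℝ) + 2 * d * Real.exp (-L) := by
  have h : sInf {n : ℕ | sigmaInf d (n + 1) ≤ ε} ≤ (heavyIndices d ε).card :=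
    Nat.sInf_le (sigmaInf_card_heavyIndices_le d hε)
  rcases Nat.eq_zero_or_pos (sInf {n : ℕ | sigmaInf d (n + 1) ≤ ε}) with h0 | h0
  · rw [h0]
    simp only [Nat.cast_zero, Real.log_zero]
    positivity
  · rw [Real.log_le_iff_le_exp (by exact_mod_cast h0)]
    exact (Nat.cast_le.mpr h).trans (card_heavyIndices_le d hε hL)

lemma le_sigmaInf (d : ℕ) {n : ℕ} (hn : 1 ≤ n) (hn3 : n ≤ 3 ^ d) :
    (1 + d : ℝ) ^ (-(1 / 2) : ℝ) ≤ sigmaInf d n := by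
  refine le_csSup ⟨1, ?_⟩ ⟨by positivity, ?_⟩
  · rintro t ⟨-, ht⟩
    obtain ⟨k, -, hk⟩ := Set.nonempty_of_ncard_ne_zero (Nat.lt_of_lt_of_le hn ht).ne'
    refine hk.trans (Real.rpow_le_one_of_one_le_of_nonpos ?_ (by norm_num))
    linarith [Finset.sum_nonneg fun j (_ : j ∈ Finset.univ) => abs_nonneg (k j : ℝ)]
  · refine hn3.trans ?_
    rw [← card_ternaryIndices, ← Set.ncard_coe_finset]
    refine Set.ncard_le_ncard (fun k hk => ?_) (finite_weight_ge d _)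
    have hk1 := mem_ternaryIndices.mp hk
    refine ⟨hk1, Real.rpow_le_rpow_of_nonpos ?_ ?_ (by norm_num)⟩
    · linarith [Finset.sum_nonneg fun j (_ : j ∈ Finset.univ) => abs_nonneg (k j : ℝ)]
    · have : ∑ j, |(k j : ℝ)| ≤ ∑ _j : Fin d, (1 : ℝ) :=
        Finset.sum_le_sum fun j _ => by exact_mod_cast hk1 j
      simp at this
      linarith

lemma three_pow_le_complexity (d : ℕ) {ε : ℝ} (hε : 0 < ε)
    (hεd : ε < (1 + d : ℝ) ^ (-(1 / 2) : ℝ)) :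
    3 ^ d ≤ sInf {n : ℕ | sigmaInf d (n + 1) ≤ ε} := by
  have hmem : sigmaInf d (sInf {n : ℕ | sigmaInf d (n + 1) ≤ ε} + 1) ≤ ε :=
    Nat.sInf_mem (s := {n : ℕ | sigmaInf d (n + 1) ≤ ε}) ⟨_, sigmaInf_card_heavyIndices_le d hε⟩
  by_contra! h
  linarith [le_sigmaInf d (Nat.le_add_left 1 _) h]

lemma MonotoneOn.exists_le_mul_add_of_isLittleO {f g : ℝ → ℝ} (hf : MonotoneOn f (Set.Ici 1))
    (hf0 : ∀ x, 1 ≤ x → 0 ≤ f x) (hg0 : ∀ x, 1 ≤ x → 0 ≤ g x) (h : f =o[atTop] g)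
    {δ : ℝ} (hδ : 0 < δ) : ∃ C, ∀ x, 1 ≤ x → f x ≤ δ * g x + C := by
  obtain ⟨x₀, h1, hx₀⟩ := (((eventually_ge_atTop (1 : ℝ)).and
    (eventually_forall_ge_atTop.mpr (h.def hδ)))).exists
  refine ⟨f x₀, fun x hx => ?_⟩
  rcases le_total x x₀ with hle | hle
  · have := mul_nonneg hδ.le (hg0 x hx)
    linarith [hf hx h1 hle]
  · have := hx₀ x hle
    rw [Real.norm_of_nonneg (hf0 x hx), Real.norm_of_nonneg (hg0 x hx)] at this
    linarith [hf0 x₀ h1]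

lemma isLittleO_rpow_rpow_atTop_of_lt {a b : ℝ} (hab : a < b) :
    (fun x : ℝ => x ^ a) =o[atTop] fun x => x ^ b := by
  rw [isLittleO_iff_tendsto' ((eventually_gt_atTop 0).mono
    fun x hx h => absurd h (Real.rpow_pos_of_pos hx b).ne')]
  refine (tendsto_rpow_neg_atTop (sub_pos.mpr hab)).congr' ?_
  filter_upwards [eventually_gt_atTop 0] with x hx
  rw [← Real.rpow_sub hx, neg_sub]

lemma exists_rpow_le_mul_rpow_add {a b δ : ℝ} (ha : 0 ≤ a) (hab : a < b) (hδ : 0 < δ) :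
    ∃ C, ∀ x : ℝ, 1 ≤ x → x ^ a ≤ δ * x ^ b + C :=
  MonotoneOn.exists_le_mul_add_of_isLittleO
    (fun x hx y _ hxy => Real.rpow_le_rpow (zero_le_one.trans hx) hxy ha)
    (fun _ _ => by positivity) (fun _ _ => by positivity)
    (isLittleO_rpow_rpow_atTop_of_lt hab) hδ

lemma exists_log_rpow_le_mul_rpow_add {a b δ : ℝ} (ha : 0 ≤ a) (hb : 0 < b) (hδ : 0 < δ) :
    ∃ C, ∀ x : ℝ, 1 ≤ x → Real.log x ^ a ≤ δ * x ^ b + C :=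
  MonotoneOn.exists_le_mul_add_of_isLittleO
    (fun x hx y _ hxy => Real.rpow_le_rpow (Real.log_nonneg hx)
      (Real.log_le_log (zero_lt_one.trans_le hx) hxy) ha)
    (fun x hx => Real.rpow_nonneg (Real.log_nonneg hx) _) (fun _ _ => by positivity)
    (isLittleO_log_rpow_rpow_atTop a hb) hδ

lemma mul_le_rpow_add_rpow {x y p : ℝ} (hx : 0 ≤ x) (hy : 0 ≤ y) (hp : 0 < p) :
    x * y ≤ x ^ (1 + p) + y ^ (1 + p⁻¹) := by
  rw [Real.rpow_one_add' hx (by positivity), Real.rpow_one_add' hy (by positivity)]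
  rcases le_total y (x ^ p) with h | h
  · have : 0 ≤ y * y ^ p⁻¹ := by positivity
    nlinarith
  · have h1 : x ≤ y ^ p⁻¹ := (Real.le_rpow_inv_iff_of_pos hx hy hp).mpr h
    have : 0 ≤ x * x ^ p := by positivity
    nlinarith

lemma log_complexity_le_mul_add {α β δ : ℝ} (hβ : 0 < β) (h : 2 < α ∨ 1 < β) (hδ : 0 < δ) :
    ∃ C, ∀ ε : ℝ, 0 < ε → ε < 1 → ∀ d : ℕ, 1 ≤ d →
      Real.log ((sInf {n : ℕ | sigmaInf d (n + 1) ≤ ε} : ℕ) : ℝ) ≤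
        δ * (ε ^ (-α) + (d : ℝ) ^ β) + C := by
  rcases h with hα | hβ1
  · set p := (α / 2 - 1) / 2 with hp
    have hp0 : 0 < p := by linarith
    obtain ⟨C₁, h₁⟩ := exists_rpow_le_mul_rpow_add (a := 1 + p) (b := α / 2)
      (by linarith) (by linarith) hδ
    obtain ⟨C₂, h₂⟩ := exists_log_rpow_le_mul_rpow_add (a := 1 + p⁻¹) (by positivity) hβ hδ
    refine ⟨C₁ + C₂ + 2, fun ε hε hε1 d hd => ?_⟩
    have hd1 : (1 : ℝ) ≤ d := by exact_mod_cast hd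
    have hd0 : (0 : ℝ) < d := by linarith
    have hm : 1 ≤ ε ^ (-2 : ℝ) :=
      Real.one_le_rpow_of_pos_of_le_one_of_nonpos hε hε1.le (by norm_num)
    have key := log_complexity_le d hε (Real.log_nonneg hd1)
    have e : 2 * (d : ℝ) * Real.exp (-Real.log d) = 2 := by
      rw [Real.exp_neg, Real.exp_log hd0]
      field_simp
    have hmul := mul_le_rpow_add_rpow (zero_le_one.trans hm) (Real.log_nonneg hd1) hp0
    have b₁ := h₁ _ hm
    have b₂ := h₂ _ hd1
    have e₂ : (ε ^ (-2 : ℝ)) ^ (α / 2) = ε ^ (-α) := by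
      rw [← Real.rpow_mul hε.le]
      ring_nf
    rw [e₂] at b₁
    linarith
  · obtain ⟨C, hC⟩ := exists_rpow_le_mul_rpow_add zero_le_one hβ1 (half_pos hδ)
    refine ⟨2 * C, fun ε hε _ d hd => ?_⟩
    have key := log_complexity_le d hε le_rfl
    have b := hC d (by exact_mod_cast hd)
    have : 0 ≤ δ * ε ^ (-α) := by positivity
    simp at key b
    linarith

lemma exists_le_rpow_add_rpow {α β : ℝ} (hα : 0 < α) (hβ : 0 < β) (K : ℝ) :
    ∃ M, ∀ ε : ℝ, 0 < ε → ∀ d : ℕ, M ≤ ε⁻¹ + d → K ≤ ε ^ (-α) + (d : ℝ) ^ β := by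
  obtain ⟨x, hxα, hxβ⟩ := ((eventually_forall_ge_atTop.mpr
    ((tendsto_rpow_atTop hα).eventually_ge_atTop K)).and (eventually_forall_ge_atTop.mpr
    ((tendsto_rpow_atTop hβ).eventually_ge_atTop K))).exists
  refine ⟨2 * x, fun ε hε d h => ?_⟩
  have h1 : 0 ≤ ε ^ (-α) := by positivity
  have h2 : 0 ≤ (d : ℝ) ^ β := by positivity
  rcases le_total x ε⁻¹ with hx | hx
  · have := hxα _ hx
    rw [Real.inv_rpow hε.le, ← Real.rpow_neg hε.le] at this
    linarith
  · linarith [hxβ d (by linarith)]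

lemma not_tractable_of_le {α β : ℝ} (hα : α ≤ 2) (hβ : β ≤ 1) (M : ℝ) :
    ∃ ε : ℝ, 0 < ε ∧ ε < 1 ∧ ∃ d : ℕ, 1 ≤ d ∧ M ≤ ε⁻¹ + d ∧
      1 / 4 ≤ Real.log ((sInf {n : ℕ | sigmaInf d (n + 1) ≤ ε} : ℕ) : ℝ)
        / (ε ^ (-α) + (d : ℝ) ^ β) := by
  obtain ⟨d, hd⟩ := exists_nat_ge (max M 1)
  have hd1 : (1 : ℝ) ≤ d := (le_max_right _ _).trans hd
  have hε : 0 < (2 + d : ℝ) ^ (-(1 / 2) : ℝ) := by positivity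
  refine ⟨(2 + d : ℝ) ^ (-(1 / 2) : ℝ), hε,
    Real.rpow_lt_one_of_one_lt_of_neg (by linarith) (by norm_num), d, by exact_mod_cast hd1,
    ?_, ?_⟩
  · have := inv_pos.mpr hε
    linarith [(le_max_left _ _).trans hd]
  · have h3 := three_pow_le_complexity d hε
      (Real.rpow_lt_rpow_of_neg (by positivity) (by linarith) (by norm_num))
    have hlog : (d : ℝ) ≤ Real.log ((sInf {n : ℕ | sigmaInf d (n + 1) ≤
        (2 + d : ℝ) ^ (-(1 / 2) : ℝ)} : ℕ) : ℝ) := by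
      rw [Real.le_log_iff_exp_le (by exact_mod_cast (pow_pos three_pos d).trans_le h3)]
      calc Real.exp d = Real.exp 1 ^ d := by rw [← Real.exp_nat_mul, mul_one]
        _ ≤ 3 ^ d := by
          gcongr
          linarith [Real.exp_one_lt_d9]
        _ ≤ _ := by exact_mod_cast h3
    have hA : ((2 + d : ℝ) ^ (-(1 / 2) : ℝ)) ^ (-α) ≤ 2 + d := by
      rw [← Real.rpow_mul (by positivity)]
      exact (Real.rpow_le_rpow_of_exponent_le (by linarith) (by linarith)).trans
        (Real.rpow_one _).le
    have hB : (d : ℝ) ^ β ≤ d :=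
      (Real.rpow_le_rpow_of_exponent_le hd1 hβ).trans (Real.rpow_one _).le
    rw [le_div_iff₀ (by positivity)]
    linarith

/-- with `n(ε,d) = min{n : σ^∞_d(n+1) ≤ ε}` the information
complexity of `I_d : W_2^∞(𝕋^d) → L_2(𝕋^d)`, for `α, β > 0` the `(α,β)`-weak
tractability condition `lim_{ε⁻¹+d→∞} ln n(ε,d)/(ε^{-α}+d^β) = 0` holds
if and only if `α > 2` or `β > 1`. -/
theorem stmt_15 (α β : ℝ) (hα : 0 < α) (hβ : 0 < β) :
    (∀ δ > 0, ∃ M : ℝ, ∀ ε : ℝ, 0 < ε → ε < 1 → ∀ d : ℕ, 1 ≤ d → M ≤ ε⁻¹ + d →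
        Real.log ((sInf {n : ℕ | sigmaInf d (n + 1) ≤ ε} : ℕ) : ℝ)
            / (ε ^ (-α) + (d : ℝ) ^ β) < δ)
      ↔ (2 < α ∨ 1 < β) := by
  constructor
  · intro h
    by_contra! hle
    obtain ⟨M, hM⟩ := h (1 / 4) (by norm_num)
    obtain ⟨ε, hε, hε1, d, hd, hMd, hq⟩ := not_tractable_of_le hle.1 hle.2 M
    exact (hM ε hε hε1 d hd hMd).not_ge hq
  · intro h δ hδ
    obtain ⟨C, hC⟩ := log_complexity_le_mul_add hβ h (half_pos hδ)
    obtain ⟨M, hM⟩ := exists_le_rpow_add_rpow hα hβ (2 * (|C| + 1) / δ)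
    refine ⟨M, fun ε hε hε1 d hd hMd => ?_⟩
    have hK := hM ε hε d hMd
    rw [div_lt_iff₀ (by positivity)]
    rw [div_le_iff₀ hδ] at hK
    linarith [hC ε hε hε1 d hd, le_abs_self C]
end

section
/- Let d ≥ 1 and R = (R_1,…,R_d) with all R_j > 0, and suppose g(R) = (1/R_1+…+1/R_d)^{-1} > 1/2. Then lim_{n→∞} n^{g(R)−1/2} · (Σ_{m=n}^∞ σ_{R,d}(m)²)^{1/2} = (2g(R)−1)^{-1/2} · (vol(B_{2R}^d))^{g(R)}, where B_{2R}^d = {x ∈ ℝ^d : Σ_{j=1}^d |x_j|^{2R_j} ≤ 1} and vol is d-dimensional Lebesgue measure. -/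
open MeasureTheory

/-- nonincreasing rearrangement of the weights `(1 + Σ_j |k_j|^{2R_j})^{-1/2}`, `k ∈ ℤ^d`. -/
noncomputable def sigmaR (d : ℕ) (R : Fin d → ℝ) (n : ℕ) : ℝ :=
  sSup {t : ℝ | 0 < t ∧
    n ≤ Set.ncard {k : Fin d → ℤ |
      t ≤ (1 + ∑ j, |(k j : ℝ)| ^ (2 * R j)) ^ (-(1 / 2) : ℝ)}}

open Filter Topology

/-- If `n ^ p * a n → L` with `1 < p`, then `n ^ (p - 1) * ∑_{m ≥ n} a m → L / (p - 1)`. -/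
theorem tendsto_rpow_sub_one_mul_tsum_tail {a : ℕ → ℝ} {p L : ℝ} (hp : 1 < p)
    (ha : Tendsto (fun n : ℕ => (n : ℝ) ^ p * a n) atTop (𝓝 L)) :
    Tendsto (fun n : ℕ => (n : ℝ) ^ (p - 1) * ∑' m, a (n + m)) atTop (𝓝 (L / (p - 1))) := by
  have hp1 : 0 < p - 1 := by linarith
  set b : ℕ → ℝ := fun n => (n : ℝ) ^ (1 - p) with hb
  have hb0 : Tendsto b atTop (𝓝 0) := by
    have := (tendsto_rpow_neg_atTop hp1).comp tendsto_natCast_atTop_atTop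
    simpa [Function.comp_def, hb] using this
  have hD : ∀ n : ℕ, 1 ≤ n → 0 < b n - b (n + 1) := by
    intro n hn
    have hn' : (0 : ℝ) < n := by exact_mod_cast hn
    have : b (n + 1) < b n := by
      simp only [hb]
      exact Real.rpow_lt_rpow_of_neg hn' (by push_cast; linarith) (by linarith)
    linarith
  have hDsum : ∀ n : ℕ, 1 ≤ n → HasSum (fun m => b (n + m) - b (n + m + 1)) (b n) := by
    intro n hn
    rw [hasSum_iff_tendsto_nat_of_nonneg (fun m => (hD _ (by omega)).le)]
    have h1 : ∀ k, ∑ m ∈ Finset.range k, (b (n + m) - b (n + m + 1)) = b n - b (n + k) := by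
      intro k
      exact Finset.sum_range_sub' (fun m => b (n + m)) k
    simp only [h1]
    have h2 : Tendsto (fun k => b (n + k)) atTop (𝓝 0) :=
      hb0.comp (tendsto_atTop_mono (fun k => Nat.le_add_left k n) tendsto_id)
    simpa using h2.const_sub (b n)
  have hDlim : Tendsto (fun n : ℕ => (n : ℝ) ^ p * (b n - b (n + 1))) atTop (𝓝 (p - 1)) := by
    have hder : HasDerivAt (fun x : ℝ => (1 + x) ^ (1 - p)) (1 - p) 0 := by
      have h := ((hasDerivAt_id (0 : ℝ)).const_add 1).rpow_const (p := 1 - p) (Or.inl (by simp))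
      simpa using h
    have hinv : Tendsto (fun n : ℕ => ((n : ℝ))⁻¹) atTop (𝓝[≠] 0) := by
      refine tendsto_nhdsWithin_iff.2 ⟨tendsto_inv_atTop_nhds_zero_nat, ?_⟩
      filter_upwards [eventually_ge_atTop 1] with n hn
      have : (0 : ℝ) < n := by exact_mod_cast hn
      simpa using this.ne'
    have h := (hasDerivAt_iff_tendsto_slope.1 hder).comp hinv |>.neg
    rw [neg_sub] at h
    refine h.congr' ?_
    filter_upwards [eventually_ge_atTop 1] with n hn
    have hn' : (0 : ℝ) < n := by exact_mod_cast hn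
    have h1 : (1 + (n : ℝ)⁻¹) = ((n : ℝ) + 1) / n := by field_simp
    simp only [Function.comp, slope_def_field, hb, h1, Nat.cast_add, Nat.cast_one]
    rw [Real.div_rpow (by positivity) hn'.le, mul_sub,
      ← Real.rpow_add hn', show (n : ℝ) ^ p = n / n ^ (1 - p) by
        rw [Real.rpow_sub hn', Real.rpow_one]; field_simp]
    simp
    ring
  have hK : Tendsto (fun n : ℕ => a n / (b n - b (n + 1))) atTop (𝓝 (L / (p - 1))) := by
    refine (ha.div hDlim hp1.ne').congr' ?_
    filter_upwards [eventually_ge_atTop 1] with n hn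
    have hn' : (0 : ℝ) < n := by exact_mod_cast hn
    exact mul_div_mul_left _ _ (Real.rpow_pos_of_pos hn' p).ne'
  set K := L / (p - 1)
  rw [Metric.tendsto_atTop] at hK ⊢
  intro ε hε
  obtain ⟨N, hN⟩ := hK (ε / 2) (by positivity)
  refine ⟨max N 1, fun n hn => ?_⟩
  have hn1 : 1 ≤ n := le_of_max_le_right hn
  have hn' : (0 : ℝ) < n := by exact_mod_cast hn1
  have hbound : ∀ m, ‖a (n + m) - K * (b (n + m) - b (n + m + 1))‖
      ≤ ε / 2 * (b (n + m) - b (n + m + 1)) := by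
    intro m
    have hpos := hD (n + m) (by omega)
    have h := hN (n + m) (by have := le_of_max_le_left hn; omega)
    rw [Real.dist_eq, div_sub' hpos.ne', abs_div, abs_of_pos hpos, div_lt_iff₀ hpos] at h
    rw [Real.norm_eq_abs, mul_comm K]
    exact h.le
  have hs := hDsum n hn1
  have hs1 := hs.mul_left (ε / 2)
  have hs2 := hs.mul_left K
  have hsum : Summable fun m => a (n + m) - K * (b (n + m) - b (n + m + 1)) :=
    Summable.of_norm_bounded hs1.summable hbound
  have hsa : Summable fun m => a (n + m) := by
    simpa using hsum.add hs2.summable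
  have hle := tsum_of_norm_bounded hs1 hbound
  rw [hsa.tsum_sub hs2.summable, hs2.tsum_eq] at hle
  have hnb : (n : ℝ) ^ (p - 1) * b n = 1 := by
    simp only [hb]
    rw [← Real.rpow_add hn']; simp
  have hpow : (0 : ℝ) < (n : ℝ) ^ (p - 1) := Real.rpow_pos_of_pos hn' _
  rw [Real.dist_eq]
  calc |(n : ℝ) ^ (p - 1) * ∑' m, a (n + m) - K|
      = |(n : ℝ) ^ (p - 1) * (∑' m, a (n + m) - K * b n)| := by
        congr 1; linear_combination K * hnb
    _ = (n : ℝ) ^ (p - 1) * |∑' m, a (n + m) - K * b n| := by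
        rw [abs_mul, abs_of_pos hpow]
    _ ≤ (n : ℝ) ^ (p - 1) * (ε / 2 * b n) := by
        gcongr; exact hle
    _ = ε / 2 := by linear_combination (ε / 2) * hnb
    _ < ε := by linarith

/-- The generalized inverse of an antitone counting function `M` with `t ^ q * M t → V` as `t → 0+`
is asymptotic to `(V / n) ^ (1 / q)`. -/
theorem tendsto_rpow_mul_sSup_of_counting {M : ℝ → ℕ} {g V : ℝ} (hg : 0 < g) (hV : 0 < V)
    (hM : AntitoneOn M (Set.Ioi 0)) (hM1 : ∀ t, 1 < t → M t = 0)
    (hlim : Tendsto (fun t : ℝ => t ^ g⁻¹ * M t) (𝓝[>] 0) (𝓝 V)) :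
    Tendsto (fun n : ℕ => (n : ℝ) ^ g * sSup {t : ℝ | 0 < t ∧ n ≤ M t}) atTop (𝓝 (V ^ g)) := by
  have key : ∀ l : ℝ, 0 < l →
      Tendsto (fun n : ℕ => (M (l * (n : ℝ) ^ (-g)) : ℝ) / n) atTop (𝓝 (V / l ^ g⁻¹)) := by
    intro l hl
    have ht : Tendsto (fun n : ℕ => l * (n : ℝ) ^ (-g)) atTop (𝓝[>] 0) := by
      refine tendsto_nhdsWithin_iff.2 ⟨?_, ?_⟩
      · simpa using ((tendsto_rpow_neg_atTop hg).comp tendsto_natCast_atTop_atTop).const_mul l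
      · filter_upwards [eventually_ge_atTop 1] with n hn
        have hn' : (0 : ℝ) < n := by exact_mod_cast hn
        exact mul_pos hl (Real.rpow_pos_of_pos hn' _)
    refine ((hlim.comp ht).div_const (l ^ g⁻¹)).congr' ?_
    filter_upwards [eventually_ge_atTop 1] with n hn
    have hn' : (0 : ℝ) < n := by exact_mod_cast hn
    have hlg : 0 < l ^ g⁻¹ := Real.rpow_pos_of_pos hl _
    simp only [Function.comp]
    rw [Real.mul_rpow hl.le (Real.rpow_nonneg hn'.le _), ← Real.rpow_mul hn'.le,
      neg_mul, mul_inv_cancel₀ hg.ne', Real.rpow_neg_one]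
    field_simp
  have hbdd : ∀ n : ℕ, 1 ≤ n → BddAbove {t : ℝ | 0 < t ∧ n ≤ M t} := by
    intro n hn
    refine ⟨1, fun t ht => ?_⟩
    by_contra! h
    have := ht.2
    rw [hM1 t h] at this
    omega
  have hpowVg : (V ^ g) ^ g⁻¹ = V := by
    rw [← Real.rpow_mul hV.le, mul_inv_cancel₀ hg.ne', Real.rpow_one]
  have hVg : 0 < V ^ g := Real.rpow_pos_of_pos hV g
  have hlower : ∀ l : ℝ, 0 < l → l < V ^ g → ∀ᶠ n : ℕ in atTop,
      l ≤ (n : ℝ) ^ g * sSup {t : ℝ | 0 < t ∧ n ≤ M t} := by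
    intro l hl hlV
    have h1 : 1 < V / l ^ g⁻¹ := by
      rw [one_lt_div (Real.rpow_pos_of_pos hl _)]
      calc l ^ g⁻¹ < (V ^ g) ^ g⁻¹ := Real.rpow_lt_rpow hl.le hlV (inv_pos.2 hg)
        _ = V := hpowVg
    filter_upwards [(key l hl).eventually (lt_mem_nhds h1), eventually_ge_atTop 1] with n h hn
    have hn' : (0 : ℝ) < n := by exact_mod_cast hn
    rw [one_lt_div hn'] at h
    have hmem : l * (n : ℝ) ^ (-g) ∈ {t : ℝ | 0 < t ∧ n ≤ M t} :=
      ⟨mul_pos hl (Real.rpow_pos_of_pos hn' _), by exact_mod_cast h.le⟩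
    have h2 := le_csSup (hbdd n hn) hmem
    calc l = (n : ℝ) ^ g * (l * (n : ℝ) ^ (-g)) := by
          rw [mul_left_comm, ← Real.rpow_add hn']; simp
      _ ≤ _ := by gcongr
  refine tendsto_order.2 ⟨fun l hl => ?_, fun u hu => ?_⟩
  · obtain ⟨l', h1, h2⟩ := exists_between (max_lt hl hVg)
    filter_upwards [hlower l' ((le_max_right _ _).trans_lt h1) h2] with n hn
    exact ((le_max_left _ _).trans_lt h1).trans_le hn
  · obtain ⟨u', h1, h2⟩ := exists_between hu
    have hu' : 0 < u' := hVg.trans h1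
    have h3 : V / u' ^ g⁻¹ < 1 := by
      rw [div_lt_one (Real.rpow_pos_of_pos hu' _)]
      calc V = (V ^ g) ^ g⁻¹ := hpowVg.symm
        _ < _ := Real.rpow_lt_rpow hVg.le h1 (inv_pos.2 hg)
    filter_upwards [(key u' hu').eventually (gt_mem_nhds h3), eventually_ge_atTop 1] with n h hn
    have hn' : (0 : ℝ) < n := by exact_mod_cast hn
    rw [div_lt_one hn'] at h
    have hpos : 0 < u' * (n : ℝ) ^ (-g) := mul_pos hu' (Real.rpow_pos_of_pos hn' _)
    have hle : sSup {t : ℝ | 0 < t ∧ n ≤ M t} ≤ u' * (n : ℝ) ^ (-g) := by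
      refine Real.sSup_le (fun t ht => ?_) hpos.le
      by_contra! hlt
      have h4 : M t ≤ M (u' * (n : ℝ) ^ (-g)) := hM hpos ht.1 hlt.le
      have h5 : (n : ℝ) ≤ M (u' * (n : ℝ) ^ (-g)) := by exact_mod_cast ht.2.trans h4
      linarith
    calc _ ≤ (n : ℝ) ^ g * (u' * (n : ℝ) ^ (-g)) := by gcongr
      _ = u' := by rw [mul_left_comm, ← Real.rpow_add hn']; simp
      _ < u := h2

/-- The volume of `E` in terms of its preimage under the anisotropic dilation
`y ↦ (s ^ a j * y j)_j`. -/
theorem volume_eq_ofReal_mul_volume_dilation_preimage {ι : Type*} [Fintype ι] (a : ι → ℝ) {s : ℝ}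
    (hs : 0 < s) {E : Set (ι → ℝ)} (hE : MeasurableSet E) :
    volume E = ENNReal.ofReal (s ^ ∑ j, a j) *
      volume {y : ι → ℝ | (fun j => s ^ a j * y j) ∈ E} := by
  classical
  have hdet : (Matrix.diagonal fun j => s ^ a j).det = s ^ ∑ j, a j := by
    rw [Matrix.det_diagonal, Real.rpow_sum_of_pos hs]
  have hpos : 0 < s ^ ∑ j, a j := Real.rpow_pos_of_pos hs _
  have h := Real.smul_map_diagonal_volume_pi (D := fun j => s ^ a j) (by rw [hdet]; exact hpos.ne')
  rw [hdet, abs_of_pos hpos] at h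
  conv_lhs => rw [← h]
  rw [Measure.smul_apply, Measure.map_apply (LinearMap.continuous_on_pi _).measurable hE,
    smul_eq_mul]
  congr 2
  ext y
  simp only [Set.mem_preimage, Set.mem_ofPred_eq]
  have : Matrix.toLin' (Matrix.diagonal fun j => s ^ a j) y = fun j => s ^ a j * y j := by
    ext j
    simp [Matrix.mulVec_diagonal]
  rw [this]

theorem measurable_pi_floor {ι : Type*} : Measurable fun (x : ι → ℝ) (j : ι) => ⌊x j⌋ :=
  measurable_pi_lambda _ fun j => Int.measurable_floor.comp (measurable_pi_apply j)

theorem tendsto_floor_mul_div_atTop (y : ℝ) :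
    Tendsto (fun l : ℝ => (⌊l * y⌋ : ℝ) / l) atTop (𝓝 y) := by
  have h1 : Tendsto (fun l : ℝ => y - l⁻¹) atTop (𝓝 y) := by
    simpa using tendsto_inv_atTop_zero.const_sub y
  refine tendsto_of_tendsto_of_tendsto_of_le_of_le' h1 tendsto_const_nhds ?_ ?_
  · filter_upwards [eventually_gt_atTop 0] with l hl
    rw [le_div_iff₀ hl, sub_mul, inv_mul_cancel₀ hl.ne']
    linarith [Int.lt_floor_add_one (l * y)]
  · filter_upwards [eventually_gt_atTop 0] with l hl
    rw [div_le_iff₀ hl]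
    linarith [Int.floor_le (l * y)]

section

variable {ι : Type*} [Fintype ι]

/-- The anisotropic gauge `∑ j, |x j| ^ (2 * R j)`. -/
noncomputable def anisotropicGauge (R : ι → ℝ) (x : ι → ℝ) : ℝ :=
  ∑ j, |x j| ^ (2 * R j)

theorem anisotropicGauge_nonneg (R x : ι → ℝ) : 0 ≤ anisotropicGauge R x :=
  Finset.sum_nonneg fun _ _ => Real.rpow_nonneg (abs_nonneg _) _

theorem continuous_anisotropicGauge {R : ι → ℝ} (hR : ∀ j, 0 < R j) :
    Continuous (anisotropicGauge R) :=
  continuous_finsetSum _ fun j _ => (continuous_apply j).abs.rpow_const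
    fun _ => Or.inr (by have := hR j; linarith)

theorem anisotropicGauge_dilation {R : ι → ℝ} (hR : ∀ j, 0 < R j) {s : ℝ} (hs : 0 < s)
    (x : ι → ℝ) :
    anisotropicGauge R (fun j => s ^ (1 / (2 * R j)) * x j) = s * anisotropicGauge R x := by
  rw [anisotropicGauge, anisotropicGauge, Finset.mul_sum]
  refine Finset.sum_congr rfl fun j _ => ?_
  have hj := hR j
  have hsj : 0 ≤ s ^ (1 / (2 * R j)) := Real.rpow_nonneg hs.le _
  rw [abs_mul, abs_of_nonneg hsj, Real.mul_rpow hsj (abs_nonneg _), ← Real.rpow_mul hs.le,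
    one_div_mul_cancel (by positivity), Real.rpow_one]

theorem abs_le_of_anisotropicGauge_le {R : ι → ℝ} (hR : ∀ j, 0 < R j) {s : ℝ} {x : ι → ℝ}
    (h : anisotropicGauge R x ≤ s) (j : ι) : |x j| ≤ s ^ (1 / (2 * R j)) := by
  have hj := hR j
  have hs : 0 ≤ s := (anisotropicGauge_nonneg R x).trans h
  rw [one_div, Real.le_rpow_inv_iff_of_pos (abs_nonneg _) hs (by positivity)]
  exact (Finset.single_le_sum (f := fun j => |x j| ^ (2 * R j))
    (fun _ _ => Real.rpow_nonneg (abs_nonneg _) _) (Finset.mem_univ j)).trans h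

theorem finite_setOf_anisotropicGauge_intCast_le {R : ι → ℝ} (hR : ∀ j, 0 < R j) (s : ℝ) :
    {k : ι → ℤ | anisotropicGauge R (fun j => (k j : ℝ)) ≤ s}.Finite := by
  classical
  refine (Set.finite_Icc (fun j => ⌊-(s ^ (1 / (2 * R j)))⌋)
    (fun j => ⌈s ^ (1 / (2 * R j))⌉)).subset fun k hk => ?_
  have h := fun j => abs_le.1 (abs_le_of_anisotropicGauge_le hR hk j)
  refine ⟨fun j => ?_, fun j => ?_⟩
  · exact_mod_cast (Int.floor_le _).trans (h j).1
  · exact_mod_cast (h j).2.trans (Int.le_ceil _)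

theorem volume_anisotropicGauge_le_ne_top {R : ι → ℝ} (hR : ∀ j, 0 < R j) (s : ℝ) :
    volume {x : ι → ℝ | anisotropicGauge R x ≤ s} ≠ ⊤ := by
  refine ((measure_mono (t := Set.Icc (fun j => -(s ^ (1 / (2 * R j))))
    (fun j => s ^ (1 / (2 * R j)))) fun x hx => ?_).trans_lt isCompact_Icc.measure_lt_top).ne
  have h := fun j => abs_le.1 (abs_le_of_anisotropicGauge_le hR hx j)
  exact ⟨fun j => (h j).1, fun j => (h j).2⟩

theorem volume_anisotropicGauge_le_one_pos {R : ι → ℝ} (hR : ∀ j, 0 < R j) :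
    0 < volume {x : ι → ℝ | anisotropicGauge R x ≤ 1} := by
  have ho : IsOpen {x : ι → ℝ | anisotropicGauge R x < 1} :=
    isOpen_lt (continuous_anisotropicGauge hR) continuous_const
  refine (ho.measure_pos volume ⟨0, ?_⟩).trans_le (measure_mono fun x hx => ?_)
  · have : anisotropicGauge R 0 = 0 := Finset.sum_eq_zero fun j _ => by
      have := hR j
      simp [Real.zero_rpow (show 2 * R j ≠ 0 by positivity)]
    simp [this]
  · exact (show anisotropicGauge R x < 1 from hx).le

theorem volume_anisotropicGauge_le {R : ι → ℝ} (hR : ∀ j, 0 < R j) {s : ℝ} (hs : 0 < s) :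
    volume {x : ι → ℝ | anisotropicGauge R x ≤ s} = ENNReal.ofReal (s ^ ∑ j, 1 / (2 * R j)) *
      volume {x : ι → ℝ | anisotropicGauge R x ≤ 1} := by
  rw [volume_eq_ofReal_mul_volume_dilation_preimage (fun j => 1 / (2 * R j)) hs
    (measurableSet_le (continuous_anisotropicGauge hR).measurable measurable_const)]
  congr 3
  ext y
  rw [Set.mem_ofPred_eq, anisotropicGauge_dilation hR hs]
  exact mul_le_iff_le_one_right hs

theorem volume_anisotropicGauge_eq_one {R : ι → ℝ} (hR : ∀ j, 0 < R j) :
    volume {x : ι → ℝ | anisotropicGauge R x = 1} = 0 := by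
  have hfin := volume_anisotropicGauge_le_ne_top hR 1
  have hmeas := (continuous_anisotropicGauge hR).measurable
  set V := volume {x : ι → ℝ | anisotropicGauge R x ≤ 1} with hV
  have hle : ∀ s : ℝ, 0 < s → s < 1 →
      volume {x : ι → ℝ | anisotropicGauge R x = 1} ≤
        V - ENNReal.ofReal (s ^ ∑ j, 1 / (2 * R j)) * V := by
    intro s hs hs1
    rw [hV, ← volume_anisotropicGauge_le hR hs, ← measure_sdiff
      (show {x : ι → ℝ | anisotropicGauge R x ≤ s} ⊆ {x | anisotropicGauge R x ≤ 1} from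
        fun x hx => le_trans (show anisotropicGauge R x ≤ s from hx) hs1.le)
      (measurableSet_le hmeas measurable_const).nullMeasurableSet
      (volume_anisotropicGauge_le_ne_top hR s)]
    refine measure_mono fun x hx => ⟨le_of_eq hx, ?_⟩
    simp only [Set.mem_ofPred_eq] at hx ⊢
    rw [hx]
    exact not_le.2 hs1
  have hlim : Tendsto (fun s : ℝ => V - ENNReal.ofReal (s ^ ∑ j, 1 / (2 * R j)) * V)
      (𝓝[<] 1) (𝓝 (V - ENNReal.ofReal (1 ^ ∑ j, 1 / (2 * R j)) * V)) := by
    refine ENNReal.Tendsto.sub tendsto_const_nhds ?_ (Or.inl hfin)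
    refine ENNReal.Tendsto.mul_const ?_ (Or.inr hfin)
    refine ENNReal.tendsto_ofReal ?_
    exact ((Real.continuousAt_rpow_const 1 _ (Or.inl one_ne_zero)).tendsto).mono_left
      nhdsWithin_le_nhds
  simp only [Real.one_rpow, ENNReal.ofReal_one, one_mul, tsub_self] at hlim
  refine le_antisymm (ge_of_tendsto hlim ?_) zero_le
  filter_upwards [Ioo_mem_nhdsLT (show (0 : ℝ) < 1 by norm_num)] with s hs
  exact hle s hs.1 hs.2

/-- The union of the unit cubes with lower corners in a finite `K ⊆ ℤ^ι` has volume `#K`. -/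
theorem volume_pi_floor_preimage {K : Set (ι → ℤ)} (hK : K.Finite) :
    volume {x : ι → ℝ | (fun j => ⌊x j⌋) ∈ K} = K.ncard := by
  have hfib : ∀ k : ι → ℤ, volume ((fun (x : ι → ℝ) j => ⌊x j⌋) ⁻¹' {k}) = 1 := by
    intro k
    have : (fun (x : ι → ℝ) j => ⌊x j⌋) ⁻¹' {k} =
        Set.univ.pi fun j => Set.Ico (k j : ℝ) (k j + 1) := by
      ext x
      simp [funext_iff, Int.floor_eq_iff]
    rw [this, Real.volume_pi_Ico]
    simp
  have h := sum_measure_preimage_singleton (μ := volume) hK.toFinset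
    (f := fun (x : ι → ℝ) j => ⌊x j⌋)
    (fun k _ => measurable_pi_floor (measurableSet_singleton k))
  simp only [hfib, Finset.sum_const, nsmul_eq_mul, mul_one, Set.Finite.coe_toFinset] at h
  rw [Set.ncard_eq_toFinset_card K hK, h]
  rfl

/-- The number of lattice points in the anisotropic ball of radius `s` is asymptotic to its
volume. -/
theorem tendsto_ncard_anisotropicGauge_le_div {R : ι → ℝ} (hR : ∀ j, 0 < R j) :
    Tendsto (fun s : ℝ => ({k : ι → ℤ | anisotropicGauge R (fun j => (k j : ℝ)) ≤ s}.ncard : ℝ) /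
      s ^ ∑ j, 1 / (2 * R j)) atTop
      (𝓝 (volume {x : ι → ℝ | anisotropicGauge R x ≤ 1}).toReal) := by
  have hcont := continuous_anisotropicGauge hR
  set K : ℝ → Set (ι → ℤ) := fun s => {k | anisotropicGauge R (fun j => (k j : ℝ)) ≤ s}
  set A : ℝ → Set (ι → ℝ) := fun s => {y | (fun j => ⌊s ^ (1 / (2 * R j)) * y j⌋) ∈ K s}
  have hcubes : ∀ s, MeasurableSet {x : ι → ℝ | (fun j => ⌊x j⌋) ∈ K s} := fun s =>
    measurable_pi_floor (Set.to_countable (K s)).measurableSet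
  have hA : ∀ s, MeasurableSet (A s) := fun s =>
    (measurable_pi_lambda _ fun j => (measurable_pi_apply j).const_mul _) (hcubes s)
  have hvol : ∀ s, 0 < s → (volume (A s)).toReal = (K s).ncard / s ^ ∑ j, 1 / (2 * R j) := by
    intro s hs
    have hpos : 0 < s ^ ∑ j, 1 / (2 * R j) := Real.rpow_pos_of_pos hs _
    have h := volume_eq_ofReal_mul_volume_dilation_preimage (fun j => 1 / (2 * R j)) hs (hcubes s)
    rw [volume_pi_floor_preimage (finite_setOf_anisotropicGauge_intCast_le hR s)] at h
    have h' := congrArg ENNReal.toReal h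
    rw [ENNReal.toReal_natCast, ENNReal.toReal_mul, ENNReal.toReal_ofReal hpos.le] at h'
    rw [eq_div_iff hpos.ne', h', mul_comm]
    rfl
  have hmain : Tendsto (fun s => volume (A s)) atTop
      (𝓝 (volume {x : ι → ℝ | anisotropicGauge R x ≤ 1})) := by
    refine tendsto_measure_of_ae_tendsto_indicator atTop
      (measurableSet_le hcont.measurable measurable_const) hA
      (B := Set.Icc (fun _ => -2) (fun _ => 2)) measurableSet_Icc
      isCompact_Icc.measure_lt_top.ne ?_ ?_
    · filter_upwards [eventually_ge_atTop 1] with s hs y hy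
      have h : ∀ j, |y j| ≤ 2 := by
        intro j
        have hj := hR j
        have hs0 : 0 < s := by linarith
        have hl : 1 ≤ s ^ (1 / (2 * R j)) := Real.one_le_rpow hs (by positivity)
        have h1 := abs_le.1 (abs_le_of_anisotropicGauge_le hR hy j)
        have h2 := Int.floor_le (s ^ (1 / (2 * R j)) * y j)
        have h3 := Int.lt_floor_add_one (s ^ (1 / (2 * R j)) * y j)
        rw [abs_le]
        constructor <;> nlinarith
      exact ⟨fun j => (abs_le.1 (h j)).1, fun j => (abs_le.1 (h j)).2⟩
    · have hne : ∀ᵐ y : ι → ℝ, anisotropicGauge R y ≠ 1 := by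
        rw [ae_iff]
        simpa using volume_anisotropicGauge_eq_one hR
      filter_upwards [hne] with y hy
      set z : ℝ → ι → ℝ := fun s j => (⌊s ^ (1 / (2 * R j)) * y j⌋ : ℝ) / s ^ (1 / (2 * R j))
      have hz : Tendsto z atTop (𝓝 y) := tendsto_pi_nhds.2 fun j =>
        (tendsto_floor_mul_div_atTop (y j)).comp
          (tendsto_rpow_atTop (by have := hR j; positivity))
      have hSz : Tendsto (fun s => anisotropicGauge R (z s)) atTop (𝓝 (anisotropicGauge R y)) :=
        (hcont.tendsto y).comp hz
      have hmem : ∀ s, 0 < s → (y ∈ A s ↔ anisotropicGauge R (z s) ≤ 1) := by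
        intro s hs
        have h1 : (fun j => ((⌊s ^ (1 / (2 * R j)) * y j⌋ : ℤ) : ℝ)) =
            fun j => s ^ (1 / (2 * R j)) * z s j := by
          ext j
          exact (mul_div_cancel₀ _ (Real.rpow_pos_of_pos hs _).ne').symm
        change anisotropicGauge R (fun j => ((⌊s ^ (1 / (2 * R j)) * y j⌋ : ℤ) : ℝ)) ≤ s ↔ _
        rw [h1, anisotropicGauge_dilation hR hs]
        exact mul_le_iff_le_one_right hs
      rcases lt_or_gt_of_ne hy with h | h
      · filter_upwards [hSz.eventually (gt_mem_nhds h), eventually_gt_atTop 0] with s h1 hs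
        rw [hmem s hs]
        exact iff_of_true h1.le h.le
      · filter_upwards [hSz.eventually (lt_mem_nhds h), eventually_gt_atTop 0] with s h1 hs
        rw [hmem s hs]
        exact iff_of_false (not_le.2 h1) (not_le.2 h)
  refine ((ENNReal.tendsto_toReal (volume_anisotropicGauge_le_ne_top hR 1)).comp hmain).congr' ?_
  filter_upwards [eventually_gt_atTop 0] with s hs
  exact hvol s hs

end

theorem le_one_add_rpow_neg_half_iff {t S : ℝ} (ht : 0 < t) (hS : 0 ≤ S) :
    t ≤ (1 + S) ^ (-(1 / 2) : ℝ) ↔ S ≤ t ^ (-2 : ℝ) - 1 := by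
  rw [show (-(1 / 2) : ℝ) = (-2 : ℝ)⁻¹ by norm_num,
    Real.le_rpow_inv_iff_of_neg ht (by linarith) (by norm_num)]
  constructor <;> intro h <;> linarith

theorem tendsto_rpow_mul_sigmaR {d : ℕ} {R : Fin d → ℝ} (hR : ∀ j, 0 < R j)
    (hg : 0 < (∑ j, 1 / R j)⁻¹) :
    Tendsto (fun n : ℕ => (n : ℝ) ^ (∑ j, 1 / R j)⁻¹ * sigmaR d R n) atTop
      (𝓝 ((volume {x : Fin d → ℝ | ∑ j, |x j| ^ (2 * R j) ≤ 1}).toReal ^ (∑ j, 1 / R j)⁻¹)) := by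
  have hset : ∀ t : ℝ, 0 < t →
      {k : Fin d → ℤ | t ≤ (1 + ∑ j, |(k j : ℝ)| ^ (2 * R j)) ^ (-(1 / 2) : ℝ)} =
        {k | anisotropicGauge R (fun j => (k j : ℝ)) ≤ t ^ (-2 : ℝ) - 1} := by
    intro t ht
    ext k
    exact le_one_add_rpow_neg_half_iff ht (anisotropicGauge_nonneg R fun j => (k j : ℝ))
  refine tendsto_rpow_mul_sSup_of_counting hg
    (ENNReal.toReal_pos (volume_anisotropicGauge_le_one_pos hR).ne'
      (volume_anisotropicGauge_le_ne_top hR 1)) ?_ ?_ ?_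
  · intro t ht u hu htu
    refine Set.ncard_le_ncard (fun k hk => htu.trans hk) ?_
    rw [hset t ht]
    exact finite_setOf_anisotropicGauge_intCast_le hR _
  · intro t ht
    rw [Set.ncard_eq_zero (by
      rw [hset t (by linarith)]; exact finite_setOf_anisotropicGauge_intCast_le hR _)]
    refine Set.eq_empty_of_forall_notMem fun k hk => ?_
    have h0 := anisotropicGauge_nonneg R fun j => (k j : ℝ)
    have : (1 + ∑ j, |(k j : ℝ)| ^ (2 * R j)) ^ (-(1 / 2) : ℝ) ≤ 1 :=
      Real.rpow_le_one_of_one_le_of_nonpos (by unfold anisotropicGauge at h0; linarith)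
        (by norm_num)
    exact absurd (ht.trans_le hk) (not_lt.2 this)
  · have hu : Tendsto (fun t : ℝ => t ^ (-2 : ℝ)) (𝓝[>] 0) atTop :=
      tendsto_rpow_neg_nhdsGT_zero (by norm_num)
    have hcount := (tendsto_ncard_anisotropicGauge_le_div hR).comp
      (tendsto_atTop_add_const_right _ (-1) hu)
    have hsum : ∑ j, 1 / (2 * R j) = (∑ j, 1 / R j) / 2 := by
      rw [Finset.sum_div]
      exact Finset.sum_congr rfl fun j _ => by ring
    have hratio : Tendsto (fun t : ℝ => (1 - t ^ (2 : ℕ)) ^ ∑ j, 1 / (2 * R j)) (𝓝[>] 0) (𝓝 1) := by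
      have h1 : Tendsto (fun t : ℝ => 1 - t ^ (2 : ℕ)) (𝓝[>] 0) (𝓝 1) := by
        have : Continuous fun t : ℝ => 1 - t ^ (2 : ℕ) := by fun_prop
        simpa using (this.tendsto 0).mono_left nhdsWithin_le_nhds
      simpa using h1.rpow_const (p := ∑ j, 1 / (2 * R j)) (Or.inl one_ne_zero)
    have h := hratio.mul hcount
    rw [one_mul] at h
    refine h.congr' ?_
    filter_upwards [Ioo_mem_nhdsGT (show (0 : ℝ) < 1 by norm_num)] with t ht
    have ht0 : 0 < t := ht.1
    have ht2 : 0 < 1 - t ^ (2 : ℕ) := by nlinarith [ht.1, ht.2]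
    have hsub : t ^ (-2 : ℝ) + -1 = (1 - t ^ (2 : ℕ)) * t ^ (-2 : ℝ) := by
      rw [Real.rpow_neg ht0.le, Real.rpow_two]
      field_simp
      ring
    rw [hset t ht0, inv_inv, Function.comp, ← sub_eq_add_neg, mul_div_assoc', mul_comm, mul_div_assoc,
      mul_comm]
    congr 1
    rw [sub_eq_add_neg (t ^ (-2 : ℝ)), hsub, Real.mul_rpow ht2.le (Real.rpow_nonneg ht0.le _),
      ← Real.rpow_mul ht0.le, hsum, show -2 * ((∑ j, 1 / R j) / 2) = -∑ j, 1 / R j by ring,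
      Real.rpow_neg ht0.le]
    have h1 := (Real.rpow_pos_of_pos ht2 ((∑ j, 1 / R j) / 2)).ne'
    field_simp

/-- if `g(R) = (Σ_j 1/R_j)⁻¹ > 1/2`, then
`lim_{n→∞} n^{g(R)−1/2}·(Σ_{m=n}^∞ σ_{R,d}(m)²)^{1/2}
  = (2g(R)−1)^{-1/2}·(vol(B_{2R}^d))^{g(R)}`;
the tail sum `Σ_{m=n}^∞ σ_{R,d}(m)²` is written as `Σ'_{m∈ℕ} σ_{R,d}(n+m)²`. -/
theorem stmt_18 (d : ℕ) (hd : 1 ≤ d) (R : Fin d → ℝ) (hR : ∀ j, 0 < R j)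
    (hg : 1 / 2 < (∑ j, 1 / R j)⁻¹) :
    Filter.Tendsto
      (fun n : ℕ => (n : ℝ) ^ ((∑ j, 1 / R j)⁻¹ - 1 / 2) *
        Real.sqrt (∑' m : ℕ, sigmaR d R (n + m) ^ 2)) Filter.atTop
      (nhds ((2 * (∑ j, 1 / R j)⁻¹ - 1) ^ (-(1 / 2) : ℝ) *
        (volume {x : Fin d → ℝ | ∑ j, |x j| ^ (2 * R j) ≤ 1}).toReal
          ^ (∑ j, 1 / R j)⁻¹)) := by
  set g := (∑ j, 1 / R j)⁻¹
  set V := (volume {x : Fin d → ℝ | ∑ j, |x j| ^ (2 * R j) ≤ 1}).toReal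
  have hV : 0 ≤ V := ENNReal.toReal_nonneg
  have hsq : Tendsto (fun n : ℕ => (n : ℝ) ^ (2 * g) * sigmaR d R n ^ 2) atTop
      (𝓝 (V ^ (2 * g))) := by
    have h := (tendsto_rpow_mul_sigmaR hR (by linarith)).pow 2
    rw [← Real.rpow_mul_natCast hV, mul_comm _ ((2 : ℕ) : ℝ)] at h
    refine h.congr fun n => ?_
    rw [mul_pow, ← Real.rpow_mul_natCast n.cast_nonneg, mul_comm _ ((2 : ℕ) : ℝ)]
    rfl
  have h := (tendsto_rpow_sub_one_mul_tsum_tail (by linarith) hsq).sqrt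
  have hlim : √(V ^ (2 * g) / (2 * g - 1)) = (2 * g - 1) ^ (-(1 / 2) : ℝ) * V ^ g := by
    rw [Real.sqrt_div (Real.rpow_nonneg hV _), Real.sqrt_eq_rpow, Real.sqrt_eq_rpow,
      ← Real.rpow_mul hV, Real.rpow_neg (by linarith), show 2 * g * (1 / 2) = g by ring]
    ring
  rw [hlim] at h
  refine h.congr fun n => ?_
  rw [Real.sqrt_mul (Real.rpow_nonneg n.cast_nonneg _), Real.sqrt_eq_rpow ((n : ℝ) ^ _),
    ← Real.rpow_mul n.cast_nonneg, show (2 * g - 1) * (1 / 2) = g - 1 / 2 by ring]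
end

section
/- Let d ≥ 1, R = (R_1,…,R_d) with all R_j > 0, u = max{R_1,…,R_d}, v = min{R_1,…,R_d}, p = max{1/2, u}, g(R) = (1/R_1+…+1/R_d)^{-1}, and E = 4^{p/v} · 2^{u/v} · (1+1/(2v))^{u/(2v²)} · (2ep)^{1/(2v)}. Then (4·d^{1/(2p)})^{p/g(R)} · vol(B_{2R}^d) ≤ E^d, where B_{2R}^d = {x ∈ ℝ^d : Σ_{j=1}^d |x_j|^{2R_j} ≤ 1} and vol is d-dimensional Lebesgue measure and e is Euler's number. -/
open MeasureTheory

/-- A crude Stirling-type upper bound for the Gamma function. -/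
theorem Real.Gamma_add_one_le_one_add_rpow {a : ℝ} (ha : 0 ≤ a) :
    Real.Gamma (a + 1) ≤ (1 + a) ^ a := by
  have key : ∀ n : ℕ, ∀ a : ℝ, 0 ≤ a → a ≤ n + 1 → Real.Gamma (a + 1) ≤ (1 + a) ^ a := by
    intro n
    induction n with
    | zero =>
      intro a h0 h1
      have h1' : a ≤ 1 := by simpa using h1
      have hconv := Real.convexOn_Gamma.2 (x := 1) (y := 2) (by simp) (by simp)
        (sub_nonneg.2 h1') h0 (by ring)
      have harg : (1 - a) • (1 : ℝ) + a • (2 : ℝ) = a + 1 := by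
        simp only [smul_eq_mul]; ring
      rw [harg, Real.Gamma_one, Real.Gamma_two] at hconv
      have hle : Real.Gamma (a + 1) ≤ 1 := by simpa using hconv
      exact hle.trans (Real.one_le_rpow (by linarith) h0)
    | succ n ih =>
      intro a h0 h1
      rcases le_total a 1 with h | h
      · exact ih a h0 (h.trans (by simp))
      · push_cast at h1
        have ha : 0 < a := by linarith
        have hprev := ih (a - 1) (by linarith) (by linarith)
        rw [sub_add_cancel, add_sub_cancel] at hprev
        calc Real.Gamma (a + 1) = a * Real.Gamma a := Real.Gamma_add_one ha.ne'
          _ ≤ a * a ^ (a - 1) := by gcongr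
          _ = a ^ a := by
            rw [Real.rpow_sub_one ha.ne']; field_simp
          _ ≤ (1 + a) ^ a := by gcongr; linarith
  exact key ⌈a⌉₊ a ha ((Nat.le_ceil a).trans (by linarith))

theorem integral_exp_neg_mul_abs_rpow {q t : ℝ} (hq : 0 < q) (ht : 0 < t) :
    ∫ x : ℝ, Real.exp (-t * |x| ^ q) = 2 * (t ^ (-1 / q) * Real.Gamma (1 / q + 1)) := by
  rw [integral_comp_abs (f := fun x => Real.exp (-t * x ^ q)), integral_exp_neg_mul_rpow hq ht]

/-- Exponential Markov bound for the volume of an anisotropic `ℓ_q`-ball. -/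
theorem volume_real_sum_rpow_le_exp_mul_prod {ι : Type*} [Fintype ι] {q : ι → ℝ}
    (hq : ∀ i, 0 < q i) {t : ℝ} (ht : 0 < t) :
    volume.real {x : ι → ℝ | ∑ i, |x i| ^ q i ≤ 1} ≤
      Real.exp t * ∏ i, (2 * (t ^ (-1 / q i) * Real.Gamma (1 / q i + 1))) := by
  have hint : ∫ x : ι → ℝ, ∏ i, Real.exp (-t * |x i| ^ q i) =
      ∏ i, (2 * (t ^ (-1 / q i) * Real.Gamma (1 / q i + 1))) := by
    rw [integral_fintype_prod_volume_eq_prod (fun i (y : ℝ) => Real.exp (-t * |y| ^ q i))]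
    exact Finset.prod_congr rfl fun i _ => integral_exp_neg_mul_abs_rpow (hq i) ht
  have hpos : 0 < ∏ i, (2 * (t ^ (-1 / q i) * Real.Gamma (1 / q i + 1))) := by
    refine Finset.prod_pos fun i _ => ?_
    have := hq i
    have := Real.Gamma_pos_of_pos (s := 1 / q i + 1) (by positivity)
    positivity
  have hmarkov := mul_meas_ge_le_integral_of_nonneg
    (Filter.Eventually.of_forall fun x : ι → ℝ =>
      Finset.prod_nonneg fun i _ => (Real.exp_pos (-t * |x i| ^ q i)).le)
    (Integrable.of_integral_ne_zero (hint ▸ hpos.ne')) (Real.exp (-t))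
  have hset : {x : ι → ℝ | Real.exp (-t) ≤ ∏ i, Real.exp (-t * |x i| ^ q i)} =
      {x : ι → ℝ | ∑ i, |x i| ^ q i ≤ 1} := by
    ext x
    simp only [Set.mem_ofPred_eq]
    rw [← Real.exp_sum, Real.exp_le_exp, ← Finset.mul_sum]
    constructor <;> intro h <;> nlinarith
  rw [hset, hint, Real.exp_neg] at hmarkov
  exact (inv_mul_le_iff₀ (Real.exp_pos t)).1 hmarkov

/-- with `u = max R`, `v = min R`, `p = max{1/2, u}`,
`g(R) = (Σ_j 1/R_j)⁻¹` and `E = 4^{p/v}·2^{u/v}·(1+1/(2v))^{u/(2v²)}·(2ep)^{1/(2v)}`,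
one has `(4·d^{1/(2p)})^{p/g(R)}·vol(B_{2R}^d) ≤ E^d`. -/
theorem stmt_19 (d : ℕ) (hd : 1 ≤ d) (R : Fin d → ℝ) (hR : ∀ j, 0 < R j)
    (u v : ℝ) (hu : IsGreatest (Set.range R) u) (hv : IsLeast (Set.range R) v)
    (p : ℝ) (hp : p = max (1/2 : ℝ) u)
    (g : ℝ) (hg : g = (∑ j, 1 / R j)⁻¹)
    (E : ℝ) (hE : E = 4 ^ (p / v) * 2 ^ (u / v)
      * (1 + 1 / (2 * v)) ^ (u / (2 * v ^ 2)) * (2 * Real.exp 1 * p) ^ (1 / (2 * v))) :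
    (4 * (d : ℝ) ^ (1 / (2 * p))) ^ (p / g)
        * (volume {x : Fin d → ℝ | ∑ j, |x j| ^ (2 * R j) ≤ 1}).toReal
      ≤ E ^ (d : ℝ) := by
  obtain ⟨⟨jv, hjv⟩, hvle⟩ := hv
  obtain ⟨⟨ju, hju⟩, hule⟩ := hu
  have hvR : ∀ j, v ≤ R j := fun j => hvle ⟨j, rfl⟩
  have hRu : ∀ j, R j ≤ u := fun j => hule ⟨j, rfl⟩
  have hv0 : 0 < v := hjv ▸ hR jv
  have hvu : v ≤ u := hju ▸ hvR ju
  have hup : u ≤ p := hp ▸ le_max_right _ _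
  have hp2 : 1 / 2 ≤ p := hp ▸ le_max_left _ _
  have hp0 : 0 < p := by linarith
  have hd0 : (0 : ℝ) < d := by exact_mod_cast hd
  have huv1 : 1 ≤ u / v := (one_le_div hv0).2 hvu
  set A : ℝ := ∑ j, 1 / (2 * R j) with hA
  have hAle : A ≤ d * (1 / (2 * v)) := by
    have h := Finset.sum_le_card_nsmul Finset.univ (fun j => 1 / (2 * R j)) (1 / (2 * v))
      fun j _ => one_div_le_one_div_of_le (by positivity) (by linarith [hvR j])
    simpa [hA] using h
  have hAge : d * (1 / (2 * p)) ≤ A := by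
    have h := Finset.card_nsmul_le_sum Finset.univ (fun j => 1 / (2 * R j)) (1 / (2 * p))
      fun j _ => one_div_le_one_div_of_le (by linarith [hR j]) (by linarith [hRu j])
    simpa [hA] using h
  have hA0 : 0 < A := lt_of_lt_of_le (by positivity) hAge
  have hginv : g⁻¹ = 2 * A := by
    rw [hg, inv_inv, hA, Finset.mul_sum]
    refine Finset.sum_congr rfl fun j _ => ?_
    have := (hR j).ne'
    field_simp
  have hpg : p / g = p * (2 * A) := by rw [div_eq_mul_inv, hginv]
  have hlead : (4 * (d : ℝ) ^ (1 / (2 * p))) ^ (p / g) = 4 ^ (p * (2 * A)) * (d : ℝ) ^ A := by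
    rw [hpg, Real.mul_rpow (by norm_num) (by positivity), ← Real.rpow_mul hd0.le]
    congr 2
    field_simp
  have hfour : (4 : ℝ) ^ (p * (2 * A)) ≤ ((4 : ℝ) ^ (p / v)) ^ (d : ℝ) := by
    rw [← Real.rpow_mul (by norm_num)]
    refine Real.rpow_le_rpow_of_exponent_le (by norm_num) ?_
    calc p * (2 * A) ≤ p * (2 * (d * (1 / (2 * v)))) := by gcongr
      _ = p / v * d := by field_simp
  have hbase : (d : ℝ) * Real.exp 1 / A ≤ 2 * Real.exp 1 * p := by
    rw [div_le_iff₀ hA0]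
    calc (d : ℝ) * Real.exp 1 = 2 * Real.exp 1 * p * (d * (1 / (2 * p))) := by field_simp
      _ ≤ 2 * Real.exp 1 * p * A := by gcongr
  have hbase1 : 1 ≤ 2 * Real.exp 1 * p := by
    nlinarith [Real.add_one_le_exp 1]
  have hscale : (d : ℝ) ^ A * (Real.exp A * A ^ (-A)) ≤
      ((2 * Real.exp 1 * p) ^ (1 / (2 * v))) ^ (d : ℝ) := by
    calc (d : ℝ) ^ A * (Real.exp A * A ^ (-A)) = ((d : ℝ) * Real.exp 1 / A) ^ A := by
          rw [Real.div_rpow (by positivity) hA0.le, Real.mul_rpow hd0.le (by positivity),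
            Real.exp_one_rpow, Real.rpow_neg hA0.le]
          ring
      _ ≤ (2 * Real.exp 1 * p) ^ A := by gcongr
      _ ≤ (2 * Real.exp 1 * p) ^ (1 / (2 * v) * d) :=
          Real.rpow_le_rpow_of_exponent_le hbase1 (by linarith)
      _ = _ := Real.rpow_mul (by positivity) _ _
  have hgamma : ∀ j, 2 * Real.Gamma (1 / (2 * R j) + 1) ≤
      2 ^ (u / v) * (1 + 1 / (2 * v)) ^ (u / (2 * v ^ 2)) := by
    intro j
    have hRj := hR j
    have ha0 : 0 < 1 / (2 * R j) := by positivity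
    have hab : 1 / (2 * R j) ≤ 1 / (2 * v) :=
      one_div_le_one_div_of_le (by positivity) (by linarith [hvR j])
    have hexp : 1 / (2 * R j) ≤ u / (2 * v ^ 2) :=
      calc 1 / (2 * R j) ≤ 1 / (2 * v) := hab
        _ ≤ 1 / (2 * v) * (u / v) := le_mul_of_one_le_right (by positivity) huv1
        _ = u / (2 * v ^ 2) := by field_simp
    have htwo : (2 : ℝ) ≤ 2 ^ (u / v) := by
      simpa using Real.rpow_le_rpow_of_exponent_le (x := 2) (by norm_num) huv1
    have hone : 1 ≤ 1 + 1 / (2 * v) := by linarith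
    have hG : Real.Gamma (1 / (2 * R j) + 1) ≤ (1 + 1 / (2 * v)) ^ (u / (2 * v ^ 2)) :=
      calc Real.Gamma (1 / (2 * R j) + 1) ≤ (1 + 1 / (2 * R j)) ^ (1 / (2 * R j)) :=
            Real.Gamma_add_one_le_one_add_rpow ha0.le
        _ ≤ (1 + 1 / (2 * v)) ^ (1 / (2 * R j)) := by gcongr
        _ ≤ (1 + 1 / (2 * v)) ^ (u / (2 * v ^ 2)) :=
            Real.rpow_le_rpow_of_exponent_le hone hexp
    exact mul_le_mul htwo hG (Real.Gamma_pos_of_pos (by positivity)).le (by positivity)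
  have hprod : ∏ j, (2 * Real.Gamma (1 / (2 * R j) + 1)) ≤
      (2 ^ (u / v) * (1 + 1 / (2 * v)) ^ (u / (2 * v ^ 2))) ^ (d : ℝ) := by
    rw [Real.rpow_natCast]
    have hnonneg : ∀ j ∈ Finset.univ, 0 ≤ 2 * Real.Gamma (1 / (2 * R j) + 1) := fun j _ => by
      have := hR j
      exact mul_nonneg zero_le_two (Real.Gamma_pos_of_pos (by positivity)).le
    simpa using Finset.prod_le_prod hnonneg fun j _ => hgamma j
  have hprod0 : 0 ≤ ∏ j, (2 * Real.Gamma (1 / (2 * R j) + 1)) :=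
    Finset.prod_nonneg fun j _ => by
      have := hR j
      exact mul_nonneg zero_le_two (Real.Gamma_pos_of_pos (by positivity)).le
  have hvol : (volume {x : Fin d → ℝ | ∑ j, |x j| ^ (2 * R j) ≤ 1}).toReal ≤
      Real.exp A * A ^ (-A) * ∏ j, (2 * Real.Gamma (1 / (2 * R j) + 1)) := by
    refine (volume_real_sum_rpow_le_exp_mul_prod
      (fun j => mul_pos two_pos (hR j)) hA0).trans_eq ?_
    have hpow : ∏ j, A ^ (-1 / (2 * R j)) = A ^ (-A) := by
      rw [← Real.rpow_sum_of_pos hA0]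
      congr 1
      simp only [hA, neg_div, Finset.sum_neg_distrib]
    rw [← hpow, mul_assoc, ← Finset.prod_mul_distrib]
    congr 1
    exact Finset.prod_congr rfl fun j _ => by ring
  have hE' : E ^ (d : ℝ) = ((4 : ℝ) ^ (p / v)) ^ (d : ℝ) *
      (((2 * Real.exp 1 * p) ^ (1 / (2 * v))) ^ (d : ℝ) *
        (2 ^ (u / v) * (1 + 1 / (2 * v)) ^ (u / (2 * v ^ 2))) ^ (d : ℝ)) := by
    rw [← Real.mul_rpow (by positivity) (by positivity),
      ← Real.mul_rpow (by positivity) (by positivity), hE]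
    ring_nf
  rw [hlead, hE']
  calc 4 ^ (p * (2 * A)) * (d : ℝ) ^ A *
        (volume {x : Fin d → ℝ | ∑ j, |x j| ^ (2 * R j) ≤ 1}).toReal
      ≤ 4 ^ (p * (2 * A)) * (d : ℝ) ^ A *
        (Real.exp A * A ^ (-A) * ∏ j, (2 * Real.Gamma (1 / (2 * R j) + 1))) := by gcongr
    _ = 4 ^ (p * (2 * A)) * ((d : ℝ) ^ A * (Real.exp A * A ^ (-A)) *
        ∏ j, (2 * Real.Gamma (1 / (2 * R j) + 1))) := by ring
    _ ≤ _ := by gcongr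
end
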